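/- arXiv:1208.5190 — 9 statements merged into one kernel-verified Lean document; each statement's English description precedes it below -/
import Mathlib

section
/- Let x and s be integers with 0 ≤ x < q and 0 ≤ s < q, let r ∈ {0,1} ⊆ K ⊆ L, let V, W ∈ K[t] be the unique polynomials with deg V, deg W < n, V(g) = g^s and W(g) = g^(x·s)·(g + r), and let u ≥ 0 be an integer with g^u ∈ D_x, with Frobenius orbit D_u = {g^(u·2^j) : 0 ≤ j < n}. Then either V(β) = 0 for every β ∈ D_u, or the set {β ∈ D_u : W(β) + V(β)^x·(g + r) = 0} has at most one element. -/
open Polynomial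

/-- The Frobenius orbit `D_u = {g^(u·2^j) : 0 ≤ j < n}` of `g^u`. -/
def gOrbit {L : Type*} [Monoid L] (n : ℕ) (g : L) (u : ℕ) : Set L :=
  {γ | ∃ j < n, γ = g ^ (u * 2 ^ j)}

theorem aeval_pow_two_pow {L : Type*} [CommRing L] [Algebra (ZMod 2) L]
    (p : Polynomial (ZMod 2)) (a : L) (k : ℕ) :
    aeval (a ^ 2 ^ k) p = aeval a p ^ 2 ^ k := by
  induction k with
  | zero => simp
  | succ k ih =>
    rw [pow_succ, pow_mul, ← expand_aeval, ZMod.expand_card, map_pow, ih, ← pow_mul]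

theorem eq_zero_of_pow_two_pow_eq {L : Type*} [Field L] {n : ℕ} {g : L}
    (hg : orderOf g = 2 ^ n - 1) {k : ℕ} (hk : k < n) (h : g ^ 2 ^ k = g) : k = 0 := by
  by_contra hk0
  have hlt : 2 ^ k < 2 ^ n := Nat.pow_lt_pow_right one_lt_two hk
  have hk2 : 2 ≤ 2 ^ k := Nat.le_self_pow hk0 2
  have hg0 : g ≠ 0 := by
    rintro rfl
    rw [orderOf_zero] at hg
    omega
  have h1 : g ^ (2 ^ k - 1) = 1 := by
    apply mul_right_cancel₀ hg0
    rw [← pow_succ, one_mul, Nat.sub_add_cancel (by omega), h]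
  have := Nat.le_of_dvd (by omega) (orderOf_dvd_of_pow_eq_one h1)
  omega

theorem exponent_eq_of_conjugate_roots {L : Type*} [Field L] [Algebra (ZMod 2) L] {n : ℕ}
    {g : L} (hg : orderOf g = 2 ^ n - 1) {x : ℕ} {r : L} (hr : r = 0 ∨ r = 1)
    {V W : Polynomial (ZMod 2)} {a : L} (hV : aeval a V ≠ 0) {i j : ℕ} (hij : i ≤ j) (hj : j < n)
    (h₁ : aeval (a ^ 2 ^ i) W + aeval (a ^ 2 ^ i) V ^ x * (g + r) = 0)
    (h₂ : aeval (a ^ 2 ^ j) W + aeval (a ^ 2 ^ j) V ^ x * (g + r) = 0) : i = j := by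
  have : CharP L 2 := charP_of_injective_algebraMap (algebraMap (ZMod 2) L).injective 2
  obtain ⟨k, rfl⟩ := Nat.exists_eq_add_of_le hij
  have hrk : r ^ 2 ^ k = r := by rcases hr with rfl | rfl <;> simp
  have h₃ := congrArg (· ^ 2 ^ k) h₁
  simp only [add_pow_char_pow, mul_pow, hrk] at h₃
  rw [← aeval_pow_two_pow, pow_right_comm (aeval _ V), ← aeval_pow_two_pow, ← pow_mul, ← pow_add,
    zero_pow (by positivity), ← h₂] at h₃
  have hne : aeval (a ^ 2 ^ (i + k)) V ^ x ≠ 0 := by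
    rw [aeval_pow_two_pow]
    exact pow_ne_zero _ (pow_ne_zero _ hV)
  have hgk : g ^ 2 ^ k = g := add_right_cancel (mul_left_cancel₀ hne (add_left_cancel h₃))
  have := eq_zero_of_pow_two_pow_eq hg (by omega) hgk
  omega

/-- Either `V` vanishes on the whole Frobenius orbit `D_u`, or
`{β ∈ D_u : W(β) + V(β)^x·(g + r) = 0}` has at most one element. -/
theorem stmt2 {L : Type*} [Field L] [Fintype L] [Algebra (ZMod 2) L]
    (n : ℕ) (hn : 2 ≤ n) (hcard : Fintype.card L = 2 ^ n)
    (g : L) (hg : orderOf g = 2 ^ n - 1)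
    (x s : ℕ) (hx : x < 2 ^ n - 1) (hs : s < 2 ^ n - 1)
    (r : L) (hr : r = 0 ∨ r = 1)
    (Y V W : Polynomial (ZMod 2))
    (hYdeg : Y.degree < (n : WithBot ℕ)) (hYg : aeval g Y = g ^ x)
    (hVdeg : V.degree < (n : WithBot ℕ)) (hVg : aeval g V = g ^ s)
    (hWdeg : W.degree < (n : WithBot ℕ)) (hWg : aeval g W = g ^ (x * s) * (g + r))
    (u : ℕ) (hu : g ^ u ≠ 0 ∧ aeval (g ^ u) Y = (g ^ u) ^ x) :
    (∀ β ∈ gOrbit n g u, aeval β V = 0) ∨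
      {β ∈ gOrbit n g u | aeval β W + (aeval β V) ^ x * (g + r) = 0}.Subsingleton := by
  by_cases hV : aeval (g ^ u) V = 0
  · left
    rintro β ⟨j, -, rfl⟩
    rw [pow_mul, aeval_pow_two_pow, hV, zero_pow (by positivity)]
  · right
    rintro _ ⟨⟨i, hi, rfl⟩, h₁⟩ _ ⟨⟨j, hj, rfl⟩, h₂⟩
    rw [pow_mul] at h₁ h₂
    rcases le_total i j with hij | hij
    · rw [exponent_eq_of_conjugate_roots hg hr hV hij hj h₁ h₂]
    · rw [exponent_eq_of_conjugate_roots hg hr hV hij hi h₂ h₁]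
end

section
/- For every integer x with 0 ≤ x < q, ε(n,g,x,g) ≥ 1 − ω(n). -/
open Polynomial

/-- The set of non-successful triples `(s, r, R)`. -/
def failSet (L : Type*) [Field L] [Algebra (ZMod 2) L] (q x : ℕ) (g : L) (D : Set L)
    (Vf : ℕ → Polynomial (ZMod 2)) (Wf : ℕ → L → Polynomial (ZMod 2)) : Set (ℕ × L × L) :=
  {t | t.1 < q ∧ (t.2.1 = 0 ∨ t.2.1 = 1) ∧ t.2.2 ∈ D ∧
    ¬ (aeval t.2.2 (Vf t.1) ≠ 0 ∧
       aeval t.2.2 (Wf t.1 t.2.1) + (aeval t.2.2 (Vf t.1)) ^ x * (g + t.2.1) = 0)}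

/-- The failure probability `ε(n,g,x,g)` = (number of non-successful triples)/(2·q·|D_x|). -/
noncomputable def epsVal (L : Type*) [Field L] [Algebra (ZMod 2) L] (q x : ℕ) (g : L)
    (D : Set L) (Vf : ℕ → Polynomial (ZMod 2)) (Wf : ℕ → L → Polynomial (ZMod 2)) : ℚ :=
  ((failSet L q x g D Vf Wf).ncard : ℚ) / ((2 * q * D.ncard : ℕ) : ℚ)

/-- `N₂(d)`: the number of monic irreducible polynomials of degree `d` over `GF(2)`. -/
noncomputable def N2 (d : ℕ) : ℕ :=
  Set.ncard {P : Polynomial (ZMod 2) | P.Monic ∧ Irreducible P ∧ P.natDegree = d}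

/-- The set `Φ_n` of integer tuples. -/
def PhiSet (n : ℕ) : Set (ℕ → ℕ) :=
  {z | z 1 ≤ 1 ∧ (∀ d, 1 < d → d < n → z d ≤ N2 d) ∧ 1 ≤ z n ∧ z n ≤ N2 n}

/-- `φ_n(z) = (z_1 + ⋯ + z_n)/(1·z_1 + ⋯ + n·z_n)` as a rational number. -/
def phiFn (n : ℕ) (z : ℕ → ℕ) : ℚ :=
  (∑ d ∈ Finset.Icc 1 n, (z d : ℚ)) / (∑ d ∈ Finset.Icc 1 n, (d : ℚ) * (z d : ℚ))

/-- Over `GF(2)` there are finitely many polynomials of a given degree. -/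
lemma finite_setOf_natDegree_eq (d : ℕ) :
    {P : Polynomial (ZMod 2) | P.Monic ∧ Irreducible P ∧ P.natDegree = d}.Finite := by
  have : Finite (Polynomial.degreeLT (ZMod 2) (d + 1)) :=
    Finite.of_equiv _ (Polynomial.degreeLTEquiv (ZMod 2) (d + 1)).toEquiv.symm
  refine Set.Finite.subset
    (Set.toFinite (Polynomial.degreeLT (ZMod 2) (d + 1) : Set (Polynomial (ZMod 2)))) ?_
  rintro P ⟨-, hP, hd⟩
  rw [SetLike.mem_coe, Polynomial.mem_degreeLT,
    ← Polynomial.natDegree_lt_iff_degree_lt hP.ne_zero]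
  omega

/-- A nonzero element of a finite field is a power of any generator of the unit group. -/
lemma exists_pow_eq_of_orderOf_eq_card_sub_one {L : Type*} [Field L] [Fintype L] {g : L} (hg : orderOf g = Fintype.card L - 1)
    {β : L} (hβ : β ≠ 0) : ∃ i : ℕ, g ^ i = β := by
  have hpos : Fintype.card L - 1 ≠ 0 := by
    have := Fintype.one_lt_card (α := L)
    omega
  have : NeZero (Fintype.card L - 1) := ⟨hpos⟩
  have hprim : IsPrimitiveRoot g (Fintype.card L - 1) := hg ▸ IsPrimitiveRoot.orderOf g
  obtain ⟨i, -, hi⟩ := hprim.eq_pow_of_pow_eq_one (FiniteField.pow_card_sub_one_eq_one β hβ)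
  exact ⟨i, hi⟩

section FiniteField

variable {L : Type*} [Field L] [Fintype L] [Algebra (ZMod 2) L]

lemma natDegree_minpoly_of_orderOf_eq_card_sub_one {g : L}
    (hg : orderOf g = Fintype.card L - 1) :
    (minpoly (ZMod 2) g).natDegree = Module.finrank (ZMod 2) L := by
  rw [← Field.primitive_element_iff_minpoly_natDegree_eq, eq_top_iff]
  intro β _
  by_cases hβ : β = 0
  · rw [hβ]
    exact zero_mem _
  · obtain ⟨i, rfl⟩ := exists_pow_eq_of_orderOf_eq_card_sub_one hg hβ
    exact pow_mem (IntermediateField.mem_adjoin_simple_self _ g) i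

lemma algEquiv_apply_eq_self_of_orderOf_eq_card_sub_one {g : L}
    (hg : orderOf g = Fintype.card L - 1) (σ : L ≃ₐ[ZMod 2] L) (hσ : σ g = g) (β : L) :
    σ β = β := by
  by_cases hβ : β = 0
  · rw [hβ, map_zero]
  · obtain ⟨i, rfl⟩ := exists_pow_eq_of_orderOf_eq_card_sub_one hg hβ
    rw [map_pow, hσ]

lemma exists_algEquiv_apply_eq_of_minpoly_eq {α β : L}
    (h : minpoly (ZMod 2) α = minpoly (ZMod 2) β) : ∃ σ : L ≃ₐ[ZMod 2] L, σ α = β := by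
  have : IsConjRoot (ZMod 2) β α := h.symm
  exact isConjRoot_iff_exists_algEquiv.mp this

open Classical in
/-- A finite set stable under Galois conjugation is counted by the degrees of the minimal
polynomials of its elements. -/
lemma card_eq_sum_natDegree_minpoly (D : Finset L)
    (hD : ∀ σ : L ≃ₐ[ZMod 2] L, ∀ β ∈ D, σ β ∈ D) :
    D.card = ∑ P ∈ D.image (minpoly (ZMod 2)), P.natDegree := by
  rw [Finset.card_eq_sum_card_image (minpoly (ZMod 2)) D]
  refine Finset.sum_congr rfl fun P hP => ?_
  obtain ⟨β, hβ, rfl⟩ := Finset.mem_image.mp hP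
  rw [← Polynomial.card_rootSet_eq_natDegree (K := L)
    (Algebra.IsSeparable.isSeparable (ZMod 2) β) (Normal.splits inferInstance β),
    ← Set.toFinset_card]
  congr 1
  ext γ
  rw [Finset.mem_filter, Set.mem_toFinset, Polynomial.mem_rootSet]
  constructor
  · rintro ⟨-, h⟩
    exact ⟨minpoly.ne_zero (Algebra.IsIntegral.isIntegral β), h ▸ minpoly.aeval _ _⟩
  · rintro ⟨-, h⟩
    have h' := minpoly.eq_of_irreducible_of_monic
      (minpoly.irreducible (Algebra.IsIntegral.isIntegral β)) h
      (minpoly.monic (Algebra.IsIntegral.isIntegral β))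
    obtain ⟨σ, rfl⟩ := exists_algEquiv_apply_eq_of_minpoly_eq h'
    exact ⟨hD σ β hβ, h'.symm⟩

open Classical in
/-- The ratio of the number of Galois orbits to the number of elements in a Galois stable set of
nonzero elements containing a generator is of the form `φ_n(z)` with `z ∈ Φ_n`. -/
lemma card_image_minpoly_div_card_mem {n : ℕ}
    (hfin : Module.finrank (ZMod 2) L = n) (D : Finset L)
    (hD : ∀ σ : L ≃ₐ[ZMod 2] L, ∀ β ∈ D, σ β ∈ D) (h0 : (0 : L) ∉ D) {g : L} (hgD : g ∈ D)
    (hg : (minpoly (ZMod 2) g).natDegree = n) :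
    ((D.image (minpoly (ZMod 2))).card : ℚ) / (D.card : ℚ) ∈ phiFn n '' PhiSet n := by
  set T := D.image (minpoly (ZMod 2)) with hT
  have hmem : ∀ P ∈ T, P.natDegree ∈ Finset.Icc 1 n := by
    intro P hP
    obtain ⟨β, -, rfl⟩ := Finset.mem_image.mp hP
    have hβ := Algebra.IsIntegral.isIntegral (R := ZMod 2) β
    exact Finset.mem_Icc.mpr ⟨minpoly.natDegree_pos hβ, hfin ▸ minpoly.natDegree_le β⟩
  have hN2 : ∀ d, (T.filter fun P => P.natDegree = d).card ≤ N2 d := by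
    intro d
    rw [← Set.ncard_coe_finset]
    refine Set.ncard_le_ncard ?_ (finite_setOf_natDegree_eq d)
    intro P hP
    obtain ⟨hP, hd⟩ := Finset.mem_filter.mp (Finset.mem_coe.mp hP)
    obtain ⟨β, -, rfl⟩ := Finset.mem_image.mp hP
    have hβ := Algebra.IsIntegral.isIntegral (R := ZMod 2) β
    exact ⟨minpoly.monic hβ, minpoly.irreducible hβ, hd⟩
  have hX1 : ∀ P ∈ T.filter (fun P => P.natDegree = 1), P = X - C 1 := by
    intro P hP
    obtain ⟨hP, hd⟩ := Finset.mem_filter.mp hP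
    obtain ⟨β, hβD, rfl⟩ := Finset.mem_image.mp hP
    obtain ⟨a, rfl⟩ := minpoly.natDegree_eq_one_iff.mp hd
    obtain rfl | rfl : a = 0 ∨ a = 1 :=
      (by decide : ∀ b : ZMod 2, b = 0 ∨ b = 1) a
    · exact absurd (by simpa using hβD) h0
    · exact minpoly.eq_X_sub_C L 1
  refine ⟨fun d => (T.filter fun P => P.natDegree = d).card,
    ⟨?_, fun d _ _ => hN2 d, ?_, hN2 n⟩, ?_⟩
  · exact Finset.card_le_one.mpr fun P hP Q hQ => (hX1 P hP).trans (hX1 Q hQ).symm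
  · exact Finset.card_pos.mpr
      ⟨_, Finset.mem_filter.mpr ⟨Finset.mem_image_of_mem _ hgD, hg⟩⟩
  · have hnum : T.card = ∑ d ∈ Finset.Icc 1 n, (T.filter fun P => P.natDegree = d).card :=
      Finset.card_eq_sum_card_fiberwise hmem
    have hden : D.card = ∑ d ∈ Finset.Icc 1 n, d * (T.filter fun P => P.natDegree = d).card := by
      rw [card_eq_sum_natDegree_minpoly D hD, ← Finset.sum_fiberwise_of_maps_to hmem]
      refine Finset.sum_congr rfl fun d _ => ?_
      rw [Finset.sum_congr rfl fun P hP => (Finset.mem_filter.mp hP).2, Finset.sum_const,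
        smul_eq_mul, mul_comm]
    rw [phiFn, hnum, hden]
    push_cast
    rfl

open Classical in
/-- The triples `(s, r, R)` that are not failures inject, up to conjugation of `R`, into
`range q × {0, 1} × {minimal polynomials}`. -/
lemma card_le_ncard_failSet_add (q x : ℕ) {g : L} (hg : orderOf g = Fintype.card L - 1)
    (D : Finset L) (Vf : ℕ → Polynomial (ZMod 2)) (Wf : ℕ → L → Polynomial (ZMod 2)) :
    2 * q * D.card ≤ (failSet L q x g D Vf Wf).ncard
      + 2 * q * (D.image (minpoly (ZMod 2))).card := by
  set A : Finset (ℕ × L × L) := Finset.range q ×ˢ ({0, 1} : Finset L) ×ˢ D with hA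
  set p : ℕ × L × L → Prop := fun t => aeval t.2.2 (Vf t.1) ≠ 0 ∧
    aeval t.2.2 (Wf t.1 t.2.1) + (aeval t.2.2 (Vf t.1)) ^ x * (g + t.2.1) = 0 with hp
  have h01 : ({0, 1} : Finset L).card = 2 := Finset.card_pair zero_ne_one
  have hAcard : A.card = 2 * q * D.card := by
    rw [hA, Finset.card_product, Finset.card_product, h01, Finset.card_range]
    ring
  have hfail : failSet L q x g D Vf Wf = (A.filter fun t => ¬ p t : Finset _) := by
    ext ⟨s, r, R⟩
    simp [failSet, hA, hp, and_assoc]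
  have hsucc : (A.filter p).card ≤ 2 * q * (D.image (minpoly (ZMod 2))).card := by
    have hcard : (Finset.range q ×ˢ ({0, 1} : Finset L) ×ˢ D.image (minpoly (ZMod 2))).card
        = 2 * q * (D.image (minpoly (ZMod 2))).card := by
      rw [Finset.card_product, Finset.card_product, h01, Finset.card_range]
      ring
    rw [← hcard]
    refine Finset.card_le_card_of_injOn (fun t => (t.1, t.2.1, minpoly (ZMod 2) t.2.2)) ?_ ?_
    · intro t ht
      have ht := (Finset.mem_filter.mp (Finset.mem_coe.mp ht)).1
      simp only [hA, Finset.mem_product] at ht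
      simp only [Finset.coe_product, Set.mem_prod, Finset.mem_coe]
      exact ⟨ht.1, ht.2.1, Finset.mem_image_of_mem _ ht.2.2⟩
    · rintro ⟨s, r, R⟩ ht ⟨s', r', R'⟩ ht' h
      obtain ⟨rfl, rfl, hR⟩ : s = s' ∧ r = r' ∧ minpoly (ZMod 2) R = minpoly (ZMod 2) R' := by
        simpa using h
      obtain ⟨σ, rfl⟩ := exists_algEquiv_apply_eq_of_minpoly_eq hR
      obtain ⟨htA, hV, hW⟩ := Finset.mem_filter.mp (Finset.mem_coe.mp ht)
      obtain ⟨-, -, hW'⟩ := Finset.mem_filter.mp (Finset.mem_coe.mp ht')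
      simp only [Polynomial.aeval_algHom_apply, ← AlgEquiv.coe_toAlgHom] at hV hW hW'
      have hr : σ r = r := by
        simp only [hA, Finset.mem_product, Finset.mem_insert, Finset.mem_singleton] at htA
        obtain h | h := htA.2.1 <;> simp [h]
      have hσW := congrArg σ hW
      have hσV : σ (aeval R (Vf s)) ≠ 0 := by simpa using hV
      simp only [AlgEquiv.coe_toAlgHom, map_add, map_mul, map_pow, map_zero, hr] at hσW hW'
      have hσg : σ g = g := by
        have := add_left_cancel (hσW.trans hW'.symm)
        exact add_right_cancel (mul_left_cancel₀ (pow_ne_zero x hσV) this)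
      rw [algEquiv_apply_eq_self_of_orderOf_eq_card_sub_one hg σ hσg R]
  rw [hfail, Set.ncard_coe_finset, ← hAcard, ← Finset.card_filter_add_card_filter_not (s := A) p]
  omega

end FiniteField

/-- For every `0 ≤ x < q`, `ε(n,g,x,g) ≥ 1 − ω(n)`, where `ω(n) = max{φ_n(z) : z ∈ Φ_n}`. -/
theorem stmt7 {L : Type*} [Field L] [Fintype L] [Algebra (ZMod 2) L]
    (n : ℕ) (hn : 2 ≤ n) (hcard : Fintype.card L = 2 ^ n)
    (g : L) (hg : orderOf g = 2 ^ n - 1)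
    (x : ℕ) (hx : x < 2 ^ n - 1)
    (Y : Polynomial (ZMod 2)) (hYdeg : Y.degree < (n : WithBot ℕ)) (hYg : aeval g Y = g ^ x)
    (D : Set L) (hD : D = {β | β ≠ 0 ∧ aeval β Y = β ^ x})
    (Vf : ℕ → Polynomial (ZMod 2)) (Wf : ℕ → L → Polynomial (ZMod 2))
    (hVf : ∀ s < 2 ^ n - 1, (Vf s).degree < (n : WithBot ℕ) ∧ aeval g (Vf s) = g ^ s)
    (hWf : ∀ s < 2 ^ n - 1, ∀ r : L, (r = 0 ∨ r = 1) →
      (Wf s r).degree < (n : WithBot ℕ) ∧ aeval g (Wf s r) = g ^ (x * s) * (g + r))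
    (ω : ℚ) (hω : IsGreatest (phiFn n '' PhiSet n) ω) :
    epsVal L (2 ^ n - 1) x g D Vf Wf ≥ 1 - ω := by
  classical
  have hord : orderOf g = Fintype.card L - 1 := by rw [hcard, hg]
  have hfin : Module.finrank (ZMod 2) L = n := by
    have h := Module.card_eq_pow_finrank (K := ZMod 2) (V := L)
    rw [hcard, ZMod.card] at h
    exact (Nat.pow_right_injective le_rfl h).symm
  have hq : 0 < 2 ^ n - 1 := by omega
  have hg0 : g ≠ 0 := by
    rintro rfl
    rw [orderOf_zero] at hg
    omega
  set F : Finset L := D.toFinset with hF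
  have hDF : D = F := (Set.coe_toFinset D).symm
  have hmemF : ∀ β, β ∈ F ↔ β ≠ 0 ∧ aeval β Y = β ^ x := by
    intro β
    rw [hF, Set.mem_toFinset, hD]
    rfl
  have hgF : g ∈ F := (hmemF g).mpr ⟨hg0, hYg⟩
  have hstable : ∀ σ : L ≃ₐ[ZMod 2] L, ∀ β ∈ F, σ β ∈ F := by
    intro σ β hβ
    obtain ⟨hβ0, hβY⟩ := (hmemF β).mp hβ
    refine (hmemF _).mpr ⟨by simpa using hβ0, ?_⟩
    rw [← map_pow, ← hβY]
    exact Polynomial.aeval_algHom_apply σ.toAlgHom β Y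
  have hle := hω.2 (card_image_minpoly_div_card_mem hfin F hstable
    (fun h => ((hmemF 0).mp h).1 rfl) hgF
    ((natDegree_minpoly_of_orderOf_eq_card_sub_one hord).trans hfin))
  have hcount := card_le_ncard_failSet_add (2 ^ n - 1) x hord F Vf Wf
  have hFpos : 0 < F.card := Finset.card_pos.mpr ⟨g, hgF⟩
  rw [hDF, epsVal, Set.ncard_coe_finset]
  generalize 2 ^ n - 1 = q at *
  have hFpos' : (0 : ℚ) < F.card := by exact_mod_cast hFpos
  have hq' : (0 : ℚ) < q := by exact_mod_cast hq
  have hcount' : (2 * q * F.card : ℚ) ≤ (failSet L q x g F Vf Wf).ncard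
      + 2 * q * (F.image (minpoly (ZMod 2))).card := by exact_mod_cast hcount
  rw [div_le_iff₀ hFpos'] at hle
  push_cast
  rw [ge_iff_le, le_div_iff₀ (mul_pos (mul_pos two_pos hq') hFpos')]
  nlinarith [mul_le_mul_of_nonneg_left hle hq'.le]
end

section
/- For every integer n ≥ 2, every tuple ξ ∈ Φ_n with φ_n(ξ) = ω(n) satisfies ξ_1 = 1 and ξ_n = 1. -/
theorem sum_mul_update (n i v : ℕ) (hi : i ∈ Finset.Icc 1 n) (f : ℕ → ℚ) (z : ℕ → ℕ) :
    ∑ d ∈ Finset.Icc 1 n, f d * (Function.update z i v d : ℚ) =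
      ∑ d ∈ Finset.Icc 1 n, f d * (z d : ℚ) + f i * ((v : ℚ) - z i) := by
  rw [← Finset.add_sum_erase _ _ hi, ← Finset.add_sum_erase _ (fun d => f d * (z d : ℚ)) hi,
    Finset.sum_congr rfl (g := fun d => f d * (z d : ℚ))
      fun d hd => by rw [Function.update_of_ne (Finset.ne_of_mem_erase hd)]]
  simp only [Function.update_self]
  ring

theorem phiFn_update (n i v : ℕ) (hi : i ∈ Finset.Icc 1 n) (z : ℕ → ℕ) :
    phiFn n (Function.update z i v) =
      (∑ d ∈ Finset.Icc 1 n, (z d : ℚ) + ((v : ℚ) - z i)) /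
        (∑ d ∈ Finset.Icc 1 n, (d : ℚ) * (z d : ℚ) + i * ((v : ℚ) - z i)) := by
  have h := sum_mul_update n i v hi (fun _ => 1) z
  simp only [one_mul] at h
  rw [phiFn, h, sum_mul_update n i v hi (fun d => (d : ℚ)) z]

/-- The weighted sum exceeds the plain sum by at least the contribution of the top index. -/
theorem sum_add_le_weighted_sum (n : ℕ) (hn : 1 ≤ n) (z : ℕ → ℕ) :
    ∑ d ∈ Finset.Icc 1 n, (z d : ℚ) + ((n : ℚ) - 1) * z n ≤
      ∑ d ∈ Finset.Icc 1 n, (d : ℚ) * (z d : ℚ) := by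
  have h := Finset.single_le_sum (s := Finset.Icc 1 n)
    (f := fun d : ℕ => ((d : ℚ) - 1) * z d) (fun d hd => by
      have : (1 : ℚ) ≤ d := by exact_mod_cast (Finset.mem_Icc.mp hd).1
      exact mul_nonneg (by linarith) (Nat.cast_nonneg _)) (Finset.mem_Icc.mpr ⟨hn, le_rfl⟩)
  simp only [sub_mul, one_mul, Finset.sum_sub_distrib] at h
  linarith

/-- The weighted sum falls short of `n` times the plain sum by at least the contribution of the
bottom index. -/
theorem weighted_sum_add_le_mul_sum (n : ℕ) (hn : 1 ≤ n) (z : ℕ → ℕ) :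
    ∑ d ∈ Finset.Icc 1 n, (d : ℚ) * (z d : ℚ) + ((n : ℚ) - 1) * z 1 ≤
      n * ∑ d ∈ Finset.Icc 1 n, (z d : ℚ) := by
  have h := Finset.single_le_sum (s := Finset.Icc 1 n)
    (f := fun d : ℕ => ((n : ℚ) - d) * z d) (fun d hd => by
      have : (d : ℚ) ≤ n := by exact_mod_cast (Finset.mem_Icc.mp hd).2
      exact mul_nonneg (by linarith) (Nat.cast_nonneg _)) (Finset.mem_Icc.mpr ⟨le_rfl, hn⟩)
  simp only [sub_mul, Finset.sum_sub_distrib, ← Finset.mul_sum] at h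
  push_cast at h
  linarith

/-- For every `n ≥ 2`, every tuple `ξ ∈ Φ_n` with `φ_n(ξ) = ω(n)` satisfies
`ξ_1 = 1` and `ξ_n = 1`. -/
theorem stmt8 (n : ℕ) (hn : 2 ≤ n)
    (ω : ℚ) (hω : IsGreatest (phiFn n '' PhiSet n) ω)
    (ξ : ℕ → ℕ) (hξ : ξ ∈ PhiSet n) (hmax : phiFn n ξ = ω) :
    ξ 1 = 1 ∧ ξ n = 1 := by
  subst hmax
  have hnq : (2 : ℚ) ≤ n := by exact_mod_cast hn
  obtain ⟨h1, hmid, hn1, hn2⟩ := hξ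
  have hznq : (1 : ℚ) ≤ ξ n := by exact_mod_cast hn1
  have hmem1 : 1 ∈ Finset.Icc 1 n := Finset.mem_Icc.mpr ⟨le_rfl, by omega⟩
  have hmemn : n ∈ Finset.Icc 1 n := Finset.mem_Icc.mpr ⟨by omega, le_rfl⟩
  have hST := sum_add_le_weighted_sum n (by omega) ξ
  have hTS := weighted_sum_add_le_mul_sum n (by omega) ξ
  have hSn : (ξ 1 : ℚ) + ξ n ≤ ∑ d ∈ Finset.Icc 1 n, (ξ d : ℚ) := by
    rw [← Finset.sum_pair (f := fun d => (ξ d : ℚ)) (show 1 ≠ n by omega)]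
    refine Finset.sum_le_sum_of_subset_of_nonneg ?_ fun _ _ _ => Nat.cast_nonneg _
    simp [Finset.insert_subset_iff, hmem1, hmemn]
  have hgap : (n : ℚ) - 1 ≤ ((n : ℚ) - 1) * ξ n := by nlinarith
  have key : ∀ i v, i ∈ Finset.Icc 1 n → Function.update ξ i v ∈ PhiSet n →
      phiFn n (Function.update ξ i v) ≤ phiFn n ξ :=
    fun i v _ h => hω.2 ⟨_, h, rfl⟩
  have hone : ξ 1 = 1 := by
    by_contra hne
    have h0 : ξ 1 = 0 := by omega
    have hle := key 1 1 hmem1 ⟨by simp, fun d hd hd' => by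
      rw [Function.update_of_ne (by omega)]; exact hmid d hd hd',
      by rwa [Function.update_of_ne (by omega)], by rwa [Function.update_of_ne (by omega)]⟩
    rw [phiFn_update n 1 1 hmem1, phiFn, h0, div_le_div_iff₀ (by push_cast; linarith)
      (by linarith)] at hle
    push_cast at hle
    linarith
  refine ⟨hone, ?_⟩
  by_contra hne
  have hge : (2 : ℚ) ≤ ξ n := by exact_mod_cast (show 2 ≤ ξ n by omega)
  have hle := key n (ξ n - 1) hmemn ⟨by rwa [Function.update_of_ne (by omega)],
    fun d hd hd' => by rw [Function.update_of_ne (by omega)]; exact hmid d hd hd',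
    by simp only [Function.update_self]; omega, by simp only [Function.update_self]; omega⟩
  have hgap2 : 2 * ((n : ℚ) - 1) ≤ ((n : ℚ) - 1) * ξ n := by nlinarith
  rw [hone] at hTS hSn
  push_cast at hTS hSn
  rw [phiFn_update n _ _ hmemn, phiFn, Nat.cast_sub hn1, div_le_div_iff₀
    (by push_cast; linarith) (by linarith)] at hle
  push_cast at hle
  linarith
end

section
/- For every integer n ≥ 3, there exists an integer h with 1 < h < n such that ω(n) = φ_n(ξ^(h)), where ξ^(h) ∈ Φ_n is the tuple with ξ^(h)_1 = 1, ξ^(h)_d = N₂(d) for 1 < d ≤ h, ξ^(h)_d = 0 for h < d < n, and ξ^(h)_n = 1. -/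
/-- The tuple `ξ^(h)`: `ξ^(h)_1 = 1`, `ξ^(h)_d = N₂(d)` for `1 < d ≤ h`,
`ξ^(h)_d = 0` for `h < d < n`, and `ξ^(h)_n = 1`. -/
noncomputable def xiH (n h : ℕ) : ℕ → ℕ := fun d =>
  if d = n then 1 else if d = 1 then 1 else if 1 < d ∧ d ≤ h then N2 d else 0

/-- The denominator of `phiFn n z` is positive on `PhiSet n`. -/
theorem phiFn_denom_pos {n : ℕ} (hn : 1 ≤ n) {z : ℕ → ℕ} (hz : z ∈ PhiSet n) :
    (0 : ℚ) < ∑ d ∈ Finset.Icc 1 n, (d : ℚ) * (z d : ℚ) := by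
  refine Finset.sum_pos' (fun d _ => by positivity) ⟨n, Finset.mem_Icc.2 ⟨hn, le_rfl⟩, ?_⟩
  have h : 0 < z n := hz.2.2.1
  positivity

/-- `phiFn n z ≤ c` is a linear inequality in `z`. -/
theorem phiFn_le_iff {n : ℕ} (hn : 1 ≤ n) {z : ℕ → ℕ} (hz : z ∈ PhiSet n) (c : ℚ) :
    phiFn n z ≤ c ↔ ∑ d ∈ Finset.Icc 1 n, (1 - c * d) * (z d : ℚ) ≤ 0 := by
  rw [phiFn, div_le_iff₀ (phiFn_denom_pos hn hz), ← sub_nonpos, Finset.mul_sum,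
    ← Finset.sum_sub_distrib]
  simp only [sub_mul, one_mul, mul_assoc]

/-- `c ≤ phiFn n z` is a linear inequality in `z`. -/
theorem le_phiFn_iff {n : ℕ} (hn : 1 ≤ n) {z : ℕ → ℕ} (hz : z ∈ PhiSet n) (c : ℚ) :
    c ≤ phiFn n z ↔ 0 ≤ ∑ d ∈ Finset.Icc 1 n, (1 - c * d) * (z d : ℚ) := by
  rw [phiFn, le_div_iff₀ (phiFn_denom_pos hn hz), ← sub_nonneg, Finset.mul_sum,
    ← Finset.sum_sub_distrib]
  simp only [sub_mul, one_mul, mul_assoc]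

theorem xiH_mem_PhiSet {n : ℕ} (h : ℕ) (hN : 1 ≤ N2 n) : xiH n h ∈ PhiSet n := by
  refine ⟨?_, fun d h1 hd => ?_, ?_, ?_⟩
  · simp [xiH]
  · rw [xiH, if_neg hd.ne, if_neg h1.ne']
    split_ifs <;> simp
  · simp [xiH]
  · simpa [xiH] using hN

theorem phiFn_le_half {n : ℕ} (hn : 3 ≤ n) {z : ℕ → ℕ} (hz : z ∈ PhiSet n) :
    phiFn n z ≤ 1 / 2 := by
  rw [phiFn_le_iff (by omega) hz]
  have key : ∀ d ∈ Finset.Icc 1 n, (1 - 1 / 2 * (d : ℚ)) * (z d : ℚ) ≤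
      (if d = 1 then 1 / 2 else 0) - (if d = n then 1 / 2 else 0) := by
    intro d hd
    have hd1 := (Finset.mem_Icc.1 hd).1
    obtain rfl | h1 := eq_or_ne d 1
    · have : (z 1 : ℚ) ≤ 1 := by exact_mod_cast hz.1
      rw [if_pos rfl, if_neg (by omega)]
      push_cast
      linarith
    · rw [if_neg h1]
      obtain rfl | h2 := eq_or_ne d n
      · have hzn : (1 : ℚ) ≤ z d := by exact_mod_cast hz.2.2.1
        have hd3 : (3 : ℚ) ≤ d := by exact_mod_cast hn
        rw [if_pos rfl]
        nlinarith
      · have hd2 : (2 : ℚ) ≤ d := by exact_mod_cast (by omega : 2 ≤ d)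
        rw [if_neg h2, sub_zero]
        exact mul_nonpos_of_nonpos_of_nonneg (by linarith) (by positivity)
  refine (Finset.sum_le_sum key).trans_eq ?_
  have h1n : 1 ≤ n := by omega
  simp [Finset.sum_sub_distrib, h1n]

/-- For every `n ≥ 3` there is an integer `1 < h < n` with
`ω(n) = φ_n(ξ^(h))`, where `ξ^(h) ∈ Φ_n`. -/
theorem stmt9 (n : ℕ) (hn : 3 ≤ n)
    (ω : ℚ) (hω : IsGreatest (phiFn n '' PhiSet n) ω) :
    ∃ h, 1 < h ∧ h < n ∧ xiH n h ∈ PhiSet n ∧ ω = phiFn n (xiH n h) := by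
  have h1n : 1 ≤ n := by omega
  obtain ⟨⟨z, hz, rfl⟩, hmax⟩ := hω
  have hN : 1 ≤ N2 n := hz.2.2.1.trans hz.2.2.2
  have hhalf := phiFn_le_half hn hz
  have hxi (h : ℕ) : xiH n h ∈ PhiSet n := xiH_mem_PhiSet h hN
  have hle (h : ℕ) : phiFn n (xiH n h) ≤ phiFn n z := hmax ⟨_, hxi h, rfl⟩
  have hz0 := (le_phiFn_iff h1n hz _).1 le_rfl
  generalize phiFn n z = c at *
  have hcn : 1 < c * n := by
    by_contra! hcon
    refine absurd ((phiFn_le_iff h1n (hxi 1) c).1 (hle 1)) (not_le.2 ?_)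
    refine Finset.sum_pos' (fun d hd => ?_) ⟨1, Finset.mem_Icc.2 ⟨le_rfl, h1n⟩, ?_⟩
    · have hd1 : (1 : ℚ) ≤ d := by exact_mod_cast (Finset.mem_Icc.1 hd).1
      have hdn : (d : ℚ) ≤ n := by exact_mod_cast (Finset.mem_Icc.1 hd).2
      refine mul_nonneg ?_ (by positivity)
      rcases le_total c 0 with hc | hc <;> nlinarith
    · have : xiH n 1 1 = 1 := by simp [xiH]
      rw [this]
      push_cast
      linarith
  have hc : 0 < c := pos_of_mul_pos_left (one_pos.trans hcn) (Nat.cast_nonneg n)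
  have hfloor (d : ℕ) : d ≤ ⌊1 / c⌋₊ ↔ c * d ≤ 1 := by
    rw [Nat.le_floor_iff (by positivity), le_div_iff₀ hc, mul_comm]
  refine ⟨⌊1 / c⌋₊, ?_, ?_, hxi _, le_antisymm ?_ (hle _)⟩
  · refine (hfloor 2).2 ?_
    push_cast
    linarith
  · exact not_le.1 fun h => absurd ((hfloor n).1 h) (not_le.2 hcn)
  · rw [le_phiFn_iff h1n (hxi _)]
    refine hz0.trans (Finset.sum_le_sum fun d hd => ?_)
    obtain ⟨hd1, hdn⟩ := Finset.mem_Icc.1 hd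
    obtain rfl | hdn' := eq_or_ne d n
    · have hzd : (1 : ℚ) ≤ z d := by exact_mod_cast hz.2.2.1
      rw [xiH, if_pos rfl]
      push_cast
      nlinarith
    obtain rfl | hd1' := eq_or_ne d 1
    · have hzd : (z 1 : ℚ) ≤ 1 := by exact_mod_cast hz.1
      rw [xiH, if_neg hdn', if_pos rfl]
      push_cast
      nlinarith
    rw [xiH, if_neg hdn', if_neg hd1']
    split_ifs with hdh
    · have hzd : (z d : ℚ) ≤ N2 d := by
        exact_mod_cast hz.2.1 d hdh.1 (lt_of_le_of_ne hdn hdn')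
      exact mul_le_mul_of_nonneg_left hzd (sub_nonneg.2 ((hfloor d).1 hdh.2))
    · have hcd : 1 < c * d := not_le.1 fun h => hdh ⟨by omega, (hfloor d).2 h⟩
      push_cast
      rw [mul_zero]
      exact mul_nonpos_of_nonpos_of_nonneg (by linarith) (by positivity)
end

section
/- For every integer n ≥ 3, h(n+1) ≥ h(n). -/
/-- The entries of `ξ^(h)` at indices up to `h`, independent of the last index. -/
noncomputable def xiInit (d : ℕ) : ℕ := if d = 1 then 1 else N2 d

theorem sum_weight_mul_xiH (w : ℕ → ℚ) {m h : ℕ} (h1 : 1 < h) (hm : h < m) :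
    ∑ d ∈ Finset.Icc 1 m, w d * (xiH m h d : ℚ) =
      ∑ d ∈ Finset.Icc 1 h, w d * (xiInit d : ℚ) + w m := by
  obtain ⟨k, rfl⟩ : ∃ k, m = k + 1 := ⟨m - 1, by omega⟩
  rw [Finset.sum_Icc_succ_top (by omega)]
  congr 1
  · symm
    apply Finset.sum_subset_zero_on_sdiff (Finset.Icc_subset_Icc_right (by omega))
    · intro d hd
      simp only [Finset.mem_sdiff, Finset.mem_Icc] at hd
      simp [xiH, show d ≠ k + 1 by omega, show d ≠ 1 by omega, show ¬ d ≤ h by omega]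
    · intro d hd
      simp only [Finset.mem_Icc] at hd
      rcases eq_or_ne d 1 with rfl | hd1
      · simp [xiH, xiInit]
      · simp [xiH, xiInit, hd1, hd.2, show d ≠ k + 1 by omega, show 1 < d by omega]
  · simp [xiH]

theorem phiFn_xiH {m h : ℕ} (h1 : 1 < h) (hm : h < m) :
    phiFn m (xiH m h) =
      (∑ d ∈ Finset.Icc 1 h, (xiInit d : ℚ) + 1) /
        (∑ d ∈ Finset.Icc 1 h, (d : ℚ) * (xiInit d : ℚ) + m) := by
  have hnum := sum_weight_mul_xiH (fun _ => 1) h1 hm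
  simp only [one_mul] at hnum
  rw [phiFn, hnum, sum_weight_mul_xiH (fun d => (d : ℚ)) h1 hm]

theorem xiH_mem_PhiSet_s11 {m : ℕ} (h : ℕ) (hne : (PhiSet m).Nonempty) :
    xiH m h ∈ PhiSet m := by
  obtain ⟨z, -, -, hz, hz'⟩ := hne
  refine ⟨?_, fun d hd hdm => ?_, ?_, ?_⟩
  · simp [xiH]
  · by_cases hdh : d ≤ h <;> simp [xiH, hdm.ne, hd, hd.ne', hdh]
  · simp [xiH]
  · simpa [xiH] using hz.trans hz'

/-- If enlarging numerator and denominator increases a fraction, it still does so after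
both denominators grow by one. -/
theorem div_add_one_lt_div_add_one {a b c d : ℚ} (hc : 0 < c) (hd : 0 < d) (hab : a ≤ b)
    (hlt : a / c < b / d) : a / (c + 1) < b / (d + 1) := by
  rw [div_lt_div_iff₀ hc hd] at hlt
  rw [div_lt_div_iff₀ (by positivity) (by positivity)]
  linarith

/-- For every integer `n ≥ 3`, `h(n+1) ≥ h(n)`, where `h(m)` is the smallest integer
`1 < h < m` with `ω(m) = φ_m(ξ^(h))`. -/
theorem stmt11 (n : ℕ) (hn : 3 ≤ n)
    (ωn ωn1 : ℚ)
    (hωn : IsGreatest (phiFn n '' PhiSet n) ωn)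
    (hωn1 : IsGreatest (phiFn (n + 1) '' PhiSet (n + 1)) ωn1)
    (hn' hn1' : ℕ)
    (hhn : IsLeast {h | 1 < h ∧ h < n ∧ ωn = phiFn n (xiH n h)} hn')
    (hhn1 : IsLeast {h | 1 < h ∧ h < n + 1 ∧ ωn1 = phiFn (n + 1) (xiH (n + 1) h)} hn1') :
    hn' ≤ hn1' := by
  obtain ⟨⟨h1, hlt, hω⟩, hmin⟩ := hhn
  obtain ⟨⟨h1', hlt', hω'⟩, -⟩ := hhn1
  by_contra! hcon
  have hne : (PhiSet n).Nonempty := Set.image_nonempty.mp ⟨_, hωn.1⟩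
  have hne' : (PhiSet (n + 1)).Nonempty := Set.image_nonempty.mp ⟨_, hωn1.1⟩
  have hstrict : phiFn n (xiH n hn1') < phiFn n (xiH n hn') := by
    rw [← hω]
    refine lt_of_le_of_ne
      (hωn.2 ⟨_, xiH_mem_PhiSet_s11 _ hne, rfl⟩) fun heq => ?_
    exact absurd (hmin ⟨h1', hcon.trans hlt, heq.symm⟩) (by omega)
  have hle : phiFn (n + 1) (xiH (n + 1) hn') ≤ phiFn (n + 1) (xiH (n + 1) hn1') := by
    rw [← hω']
    exact hωn1.2 ⟨_, xiH_mem_PhiSet_s11 _ hne', rfl⟩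
  rw [phiFn_xiH h1' (by omega), phiFn_xiH h1 hlt] at hstrict
  rw [phiFn_xiH h1' hlt', phiFn_xiH h1 (by omega)] at hle
  push_cast at hle
  simp only [← add_assoc] at hle
  have hn0 : (0 : ℚ) < n := by exact_mod_cast (by omega : 0 < n)
  refine hle.not_gt (div_add_one_lt_div_add_one (by positivity) (by positivity) ?_ hstrict)
  gcongr
end

section
/- For every integer n ≥ 3, ω(n+1) < ω(n). -/
open Polynomial in
theorem finite_setOf_natDegree_eq_s12 (R : Type*) [Semiring R] [Finite R] (d : ℕ) :
    {P : R[X] | P.natDegree = d}.Finite := by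
  refine Set.Finite.of_injOn (f := fun P (i : Fin (d + 1)) => P.coeff i)
    (Set.mapsTo_univ _ _) ?_ Set.finite_univ
  intro P hP Q hQ h
  ext i
  rcases Nat.lt_or_ge i (d + 1) with hi | hi
  · exact congrFun h ⟨i, hi⟩
  · rw [coeff_eq_zero_of_natDegree_lt (hP.trans_lt hi),
      coeff_eq_zero_of_natDegree_lt (hQ.trans_lt hi)]

open Polynomial in
theorem exists_monic_irreducible_natDegree_eq (p : ℕ) [Fact p.Prime] {d : ℕ} (hd : d ≠ 0) :
    ∃ P : (ZMod p)[X], P.Monic ∧ Irreducible P ∧ P.natDegree = d := by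
  obtain ⟨α, hα⟩ := Field.exists_primitive_element (ZMod p) (GaloisField p d)
  have hint : IsIntegral (ZMod p) α := IsIntegral.of_finite _ _
  refine ⟨minpoly (ZMod p) α, minpoly.monic hint, minpoly.irreducible hint, ?_⟩
  rw [(Field.primitive_element_iff_minpoly_natDegree_eq (ZMod p) α).1 hα, GaloisField.finrank p hd]

theorem one_le_N2 {d : ℕ} (hd : d ≠ 0) : 1 ≤ N2 d :=
  (Set.ncard_pos ((finite_setOf_natDegree_eq_s12 (ZMod 2) d).subset fun _ h => h.2.2)).2
    (exists_monic_irreducible_natDegree_eq 2 hd)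

/-- Discarding the entries in degree `n + 1`, and inserting one in degree `n` if there is none,
strictly increases the ratio. -/
theorem exists_phiFn_succ_lt {n : ℕ} (hn : 2 ≤ n) {z : ℕ → ℕ} (hz : z ∈ PhiSet (n + 1)) :
    ∃ w ∈ PhiSet n, phiFn (n + 1) z < phiFn n w := by
  obtain ⟨hz1, hzd, hk, -⟩ := hz
  have hS : (0 : ℚ) ≤ ∑ d ∈ Finset.Icc 1 n, (z d : ℚ) := by positivity
  have hTS : ∑ d ∈ Finset.Icc 1 n, (d : ℚ) * (z d : ℚ) ≤ n * ∑ d ∈ Finset.Icc 1 n, (z d : ℚ) := by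
    rw [Finset.mul_sum]
    gcongr with d hd
    exact (Finset.mem_Icc.1 hd).2
  have hn0 : (0 : ℚ) < n := by exact_mod_cast (by omega : 0 < n)
  have hk' : (1 : ℚ) ≤ z (n + 1) := by exact_mod_cast hk
  have hmem : n ∈ Finset.Icc 1 n := Finset.mem_Icc.2 ⟨by omega, le_rfl⟩
  rcases Nat.eq_zero_or_pos (z n) with h0 | hpos
  · refine ⟨Function.update z n 1, ⟨?_, fun d hd hdn => ?_, ?_, ?_⟩, ?_⟩
    · rwa [Function.update_of_ne (by omega)]
    · rw [Function.update_of_ne hdn.ne]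
      exact hzd d hd (by omega)
    · simp
    · simpa using one_le_N2 (by omega : n ≠ 0)
    have hsum (f : ℕ → ℚ) : ∑ d ∈ Finset.Icc 1 n, f d * (Function.update z n 1 d : ℕ) =
        ∑ d ∈ Finset.Icc 1 n, f d * (z d : ℚ) + f n := by
      rw [← Finset.add_sum_erase _ _ hmem, ← Finset.add_sum_erase _ (fun d => f d * (z d : ℚ)) hmem,
        Finset.sum_congr rfl (g := fun d => f d * (z d : ℚ)) fun d hd => by
          rw [Function.update_of_ne (Finset.ne_of_mem_erase hd)]]
      simp [h0, add_comm]
    have hsum1 := hsum fun _ => 1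
    simp only [one_mul] at hsum1
    rw [phiFn, phiFn, hsum1, hsum, Finset.sum_Icc_succ_top (by omega),
      Finset.sum_Icc_succ_top (by omega)]
    push_cast
    rw [div_lt_div_iff₀ (by positivity) (by positivity)]
    nlinarith [mul_le_mul_of_nonneg_right hTS (sub_nonneg.2 hk'),
      mul_nonneg hS (by linarith : (0 : ℚ) ≤ z (n + 1))]
  · refine ⟨z, ⟨hz1, fun d hd hdn => hzd d hd (by omega), hpos, hzd n (by omega) (by omega)⟩, ?_⟩
    have hzn : (0 : ℚ) < z n := by exact_mod_cast hpos
    have hS' : (0 : ℚ) < ∑ d ∈ Finset.Icc 1 n, (z d : ℚ) :=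
      Finset.sum_pos' (fun _ _ => by positivity) ⟨n, hmem, hzn⟩
    have hT' : (0 : ℚ) < ∑ d ∈ Finset.Icc 1 n, (d : ℚ) * (z d : ℚ) :=
      Finset.sum_pos' (fun _ _ => by positivity) ⟨n, hmem, by positivity⟩
    rw [phiFn, phiFn, Finset.sum_Icc_succ_top (by omega), Finset.sum_Icc_succ_top (by omega)]
    push_cast
    rw [div_lt_div_iff₀ (by positivity) hT']
    nlinarith [mul_le_mul_of_nonneg_right hTS (by linarith : (0 : ℚ) ≤ z (n + 1)),
      mul_pos hS' (by linarith : (0 : ℚ) < z (n + 1))]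

/-- For every integer `n ≥ 3`, `ω(n+1) < ω(n)`. -/
theorem stmt12 (n : ℕ) (hn : 3 ≤ n)
    (ωn ωn1 : ℚ)
    (hωn : IsGreatest (phiFn n '' PhiSet n) ωn)
    (hωn1 : IsGreatest (phiFn (n + 1) '' PhiSet (n + 1)) ωn1) :
    ωn1 < ωn := by
  obtain ⟨⟨z, hz, rfl⟩, -⟩ := hωn1
  obtain ⟨w, hw, hlt⟩ := exists_phiFn_succ_lt (by omega) hz
  exact hlt.trans_le (hωn.2 ⟨w, hw, rfl⟩)
end

section
/- For every integer n with 2 ≤ n ≤ 6, ω(n) ≤ 2/n. -/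
open Polynomial in
/-- The only monic irreducible quadratic over `GF(2)` is `X ^ 2 + X + 1`. -/
theorem eq_of_irreducible_of_natDegree_eq_two {P : Polynomial (ZMod 2)} (hm : P.Monic)
    (hirr : Irreducible P) (hd : P.natDegree = 2) : P = X ^ 2 + X + 1 := by
  have hroot (x : ZMod 2) : P.eval x ≠ 0 :=
    hirr.not_isRoot_of_natDegree_ne_one (by omega)
  have h2 : P.coeff 2 = 1 := by
    simpa only [hd] using hm.coeff_natDegree
  have h0 := hroot 0
  have h1 := hroot 1
  rw [eval_eq_sum_range, hd] at h0 h1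
  simp only [Finset.sum_range_succ, Finset.sum_range_zero, h2] at h0 h1
  have hc : P.coeff 0 = 1 ∧ P.coeff 1 = 1 := by
    generalize P.coeff 0 = a at *
    generalize P.coeff 1 = b at *
    revert a b
    decide
  rw [P.as_sum_range, hd]
  simp only [Finset.sum_range_succ, Finset.sum_range_zero, h2, hc.1, hc.2,
    ← C_mul_X_pow_eq_monomial, map_one]
  ring

theorem N2_two_le_one : N2 2 ≤ 1 := by
  refine (Set.ncard_le_ncard (t := {Polynomial.X ^ 2 + Polynomial.X + 1}) ?_).trans
    (Set.ncard_singleton _).le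
  rintro P ⟨hm, hirr, hd⟩
  exact eq_of_irreducible_of_natDegree_eq_two hm hirr hd

/-- For every integer `n` with `2 ≤ n ≤ 6`, `ω(n) ≤ 2/n`. -/
theorem stmt14 (n : ℕ) (hn2 : 2 ≤ n) (hn6 : n ≤ 6)
    (ω : ℚ) (hω : IsGreatest (phiFn n '' PhiSet n) ω) :
    ω ≤ 2 / (n : ℚ) := by
  obtain ⟨z, ⟨hz1, hzd, hzn, -⟩, rfl⟩ := hω.1
  have hz2 (h : 2 < n) : z 2 ≤ 1 := (hzd 2 one_lt_two h).trans N2_two_le_one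
  have key : n * ∑ d ∈ Finset.Icc 1 n, z d ≤ 2 * ∑ d ∈ Finset.Icc 1 n, d * z d := by
    clear hω hzd
    interval_cases n <;> simp [Finset.sum_Icc_succ_top] at hz2 ⊢ <;> omega
  have hpos : 0 < ∑ d ∈ Finset.Icc 1 n, d * z d :=
    Finset.sum_pos' (fun _ _ => Nat.zero_le _)
      ⟨n, Finset.mem_Icc.mpr ⟨by omega, le_rfl⟩, Nat.mul_pos (by omega) hzn⟩
  have hn : (0 : ℚ) < n := by exact_mod_cast (by omega : 0 < n)
  rw [phiFn, div_le_div_iff₀ (by exact_mod_cast hpos) hn, mul_comm _ (n : ℚ)]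
  exact_mod_cast key
end

section
/- For every F ∈ 𝒫 and every integer x with 0 ≤ x < q, ε(n,g,x,F) ≥ 1 − ω(n); consequently, if 2 ≤ n ≤ 6 or n ≥ 7 is composite then η(n,g,F) ≥ 1 − ω(n), and if n ≥ 7 is prime then η(n,g,F) ≥ 1 − 2/n. -/
open Polynomial

/-- The set `𝒫` of polynomials over `L` with one coefficient of multiplicative order
`2^n − 1` and all other coefficients in `K = GF(2)`. -/
def PolySet (L : Type*) [Field L] [Algebra (ZMod 2) L] (n : ℕ) : Set (Polynomial L) :=
  {F | ∃ l, orderOf (F.coeff l) = 2 ^ n - 1 ∧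
        ∀ k, k ≠ l → F.coeff k ∈ Set.range (algebraMap (ZMod 2) L)}

/-- The set of non-`F`-successful triples `(s, r, R)`. -/
def failSetF (L : Type*) [Field L] [Algebra (ZMod 2) L] (q x : ℕ) (F : Polynomial L)
    (D : Set L) (Vf : ℕ → Polynomial (ZMod 2)) (Wf : ℕ → L → Polynomial (ZMod 2)) :
    Set (ℕ × L × L) :=
  {t | t.1 < q ∧ (t.2.1 = 0 ∨ t.2.1 = 1) ∧ t.2.2 ∈ D ∧
    ¬ (aeval t.2.2 (Vf t.1) ≠ 0 ∧
       aeval t.2.2 (Wf t.1 t.2.1) +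
         (aeval t.2.2 (Vf t.1)) ^ x * (Polynomial.eval t.2.2 F + t.2.1) = 0)}

/-- The failure probability `ε(n,g,x,F)`
= (number of non-`F`-successful triples)/(2·q·|D_x|). -/
noncomputable def epsValF (L : Type*) [Field L] [Algebra (ZMod 2) L] (q x : ℕ)
    (F : Polynomial L) (D : Set L) (Vf : ℕ → Polynomial (ZMod 2))
    (Wf : ℕ → L → Polynomial (ZMod 2)) : ℚ :=
  ((failSetF L q x F D Vf Wf).ncard : ℚ) / ((2 * q * D.ncard : ℕ) : ℚ)

/-- `η(n,g,F) = (1/q)·Σ_{x=0}^{q−1} ε(n,g,x,F)`. -/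
noncomputable def etaValF (L : Type*) [Field L] [Algebra (ZMod 2) L] (q : ℕ)
    (F : Polynomial L) (Dfam : ℕ → Set L) (Vf : ℕ → Polynomial (ZMod 2))
    (Wf : ℕ → ℕ → L → Polynomial (ZMod 2)) : ℚ :=
  (1 / (q : ℚ)) * ∑ x ∈ Finset.range q, epsValF L q x F (Dfam x) Vf (Wf x)

/-- A polynomial in `𝒫` is a rational polynomial plus one monomial with coefficient of
order `2 ^ n - 1`. -/
theorem PolySet.exists_eval_eq {L : Type*} [Field L] [Algebra (ZMod 2) L] {n : ℕ}
    {F : Polynomial L} (hF : F ∈ PolySet L n) :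
    ∃ (c : L) (l : ℕ) (P : Polynomial (ZMod 2)), orderOf c = 2 ^ n - 1 ∧
      ∀ R : L, eval R F = c * R ^ l + aeval R P := by
  obtain ⟨l, hc, hK⟩ := hF
  have hlift : F - monomial l (F.coeff l) ∈ lifts (algebraMap (ZMod 2) L) := by
    rw [lifts_iff_coeff_lifts]
    intro k
    rw [coeff_sub, coeff_monomial]
    by_cases h : l = k
    · subst h
      simp
    · rw [if_neg h, sub_zero]
      exact hK k (Ne.symm h)
  obtain ⟨P, hP⟩ := (mem_lifts _).1 hlift
  refine ⟨F.coeff l, l, P, hc, fun R => ?_⟩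
  rw [← eval_map_algebraMap, hP, eval_sub, eval_monomial]
  ring

/-- An element of order `2 ^ n - 1` has trivial stabilizer under the first `n` powers of
Frobenius. -/
theorem eq_zero_of_pow_two_pow_eq_self {L : Type*} [Field L] {n i : ℕ} {c : L} (hn : 2 ≤ n)
    (hc : orderOf c = 2 ^ n - 1) (hi : i < n) (h : c ^ 2 ^ i = c) : i = 0 := by
  have hn4 : 2 ^ 2 ≤ 2 ^ n := Nat.pow_le_pow_right two_pos hn
  have hin : 2 ^ i < 2 ^ n := Nat.pow_lt_pow_right one_lt_two hi
  have hi1 : 1 ≤ 2 ^ i := Nat.one_le_two_pow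
  have hc0 : c ≠ 0 := by
    rintro rfl
    rw [orderOf_zero] at hc
    omega
  have h1 : c ^ (2 ^ i - 1) = 1 := by
    apply mul_right_cancel₀ hc0
    rw [← pow_succ, Nat.sub_add_cancel hi1, h, one_mul]
  have hdvd := orderOf_dvd_of_pow_eq_one h1
  rw [hc] at hdvd
  have h0 := Nat.eq_zero_of_dvd_of_lt hdvd (by omega)
  by_contra hne
  have := Nat.one_lt_two_pow hne
  omega

/-- The set of `F`-successful triples `(s, r, R)`. -/
def successSet (L : Type*) [Field L] [Algebra (ZMod 2) L] (q x : ℕ) (F : Polynomial L)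
    (D : Set L) (Vf : ℕ → Polynomial (ZMod 2)) (Wf : ℕ → L → Polynomial (ZMod 2)) :
    Set (ℕ × L × L) :=
  {t | t.1 < q ∧ (t.2.1 = 0 ∨ t.2.1 = 1) ∧ t.2.2 ∈ D ∧
    (aeval t.2.2 (Vf t.1) ≠ 0 ∧
       aeval t.2.2 (Wf t.1 t.2.1) +
         (aeval t.2.2 (Vf t.1)) ^ x * (Polynomial.eval t.2.2 F + t.2.1) = 0)}

/-- The set of all triples `(s, r, R)`. -/
def tripleSet (L : Type*) [Field L] (q : ℕ) (D : Set L) : Set (ℕ × L × L) :=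
  Set.Iio q ×ˢ ({0, 1} : Set L) ×ˢ D

theorem ncard_tripleSet (L : Type*) [Field L] (q : ℕ) (D : Set L) :
    (tripleSet L q D).ncard = 2 * q * D.ncard := by
  rw [tripleSet, Set.ncard_prod, Set.ncard_prod, Set.ncard_pair zero_ne_one,
    Set.ncard_eq_toFinset_card', Set.toFinset_Iio, Nat.card_Iio]
  ring

/-- If two Frobenius conjugates are both successful for the same `(s, r)`, they agree. -/
theorem eq_zero_of_success_of_success_conj {L : Type*} [Field L] [Algebra (ZMod 2) L]
    {n x l i : ℕ} (hn : 2 ≤ n) {c r R : L} {P V W : Polynomial (ZMod 2)} {F : Polynomial L}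
    (hc : orderOf c = 2 ^ n - 1) (hF : ∀ R : L, eval R F = c * R ^ l + aeval R P)
    (hr : r = 0 ∨ r = 1) (σ : L →ₐ[ZMod 2] L) (hσ : ∀ a, σ a = a ^ 2 ^ i) (hi : i < n)
    (hR : R ≠ 0) (hV : aeval R V ≠ 0)
    (h : aeval R W + aeval R V ^ x * (eval R F + r) = 0)
    (h' : aeval (σ R) W + aeval (σ R) V ^ x * (eval (σ R) F + r) = 0) : i = 0 := by
  apply eq_zero_of_pow_two_pow_eq_self hn hc hi
  rw [← hσ]
  have hσr : σ r = r := by rcases hr with rfl | rfl <;> simp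
  have hs := congrArg σ h
  rw [hF] at h' hs
  simp only [map_add, map_mul, map_pow, hσr, map_zero, aeval_algHom_apply] at h' hs
  have hne : σ (aeval R V) ^ x * σ R ^ l ≠ 0 :=
    mul_ne_zero (pow_ne_zero _ ((map_ne_zero σ).2 hV)) (pow_ne_zero _ ((map_ne_zero σ).2 hR))
  apply mul_left_cancel₀ hne
  linear_combination hs - h'

theorem mul_ncard_successSet_le {L : Type*} [Field L] [Finite L] [Algebra (ZMod 2) L]
    {n q x : ℕ} (hn : 2 ≤ n) {F : Polynomial L} (hF : F ∈ PolySet L n)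
    {D : Set L} (hD0 : ∀ β ∈ D, β ≠ 0)
    (hD : ∀ β ∈ D, ∀ σ : L →ₐ[ZMod 2] L, σ β ∈ D)
    (Vf : ℕ → Polynomial (ZMod 2)) (Wf : ℕ → L → Polynomial (ZMod 2)) :
    (successSet L q x F D Vf Wf).ncard * n ≤ 2 * q * D.ncard := by
  obtain ⟨c, l, P, hc, hFe⟩ := PolySet.exists_eval_eq hF
  let σ : ℕ → L →ₐ[ZMod 2] L := fun j => FiniteField.frobeniusAlgHom (ZMod 2) L ^ j
  have hσ : ∀ j a, σ j a = a ^ 2 ^ j := by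
    intro j a
    simp [σ, AlgHom.coe_pow, FiniteField.coe_frobeniusAlgHom, pow_iterate]
  have key : ∀ s r R R' j j', j ≤ j' → j' < n → (s, r, R) ∈ successSet L q x F D Vf Wf →
      (s, r, R') ∈ successSet L q x F D Vf Wf → σ j R = σ j' R' → j = j' ∧ R = R' := by
    intro s r R R' j j' hjj' hj' h h' he
    obtain ⟨i, rfl⟩ := Nat.exists_eq_add_of_le hjj'
    have hRR : R = σ i R' := by
      refine (σ j).toRingHom.injective (he.trans ?_)
      change σ (j + i) R' = σ j (σ i R')
      simp only [hσ]
      rw [← pow_mul, ← pow_add, add_comm]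
    obtain ⟨-, hr, hRD, hV, hW⟩ := h
    obtain ⟨-, -, hRD', hV', hW'⟩ := h'
    dsimp only at hr hRD hV hW hRD' hV' hW'
    rw [hRR] at hW
    have hi : i = 0 := eq_zero_of_success_of_success_conj hn hc hFe hr (σ i) (hσ i)
      (by omega) (hD0 _ hRD') hV' hW' hW
    subst hi
    exact ⟨rfl, by rw [hRR, hσ, pow_zero, pow_one]⟩
  have hfin : (tripleSet L q D).Finite :=
    (Set.finite_Iio q).prod ((Set.toFinite _).prod (Set.toFinite _))
  rw [← ncard_tripleSet]
  have hcn : (Set.Iio n).ncard = n := by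
    rw [Set.ncard_eq_toFinset_card', Set.toFinset_Iio, Nat.card_Iio]
  conv_lhs => rw [← hcn]
  rw [← Set.ncard_prod]
  refine Set.ncard_le_ncard_of_injOn (fun p => (p.1.1, p.1.2.1, σ p.2 p.1.2.2)) ?_ ?_ hfin
  · rintro ⟨⟨s, r, R⟩, j⟩ ⟨⟨hs, hr, hR, -⟩, -⟩
    exact ⟨hs, hr, hD _ hR _⟩
  · rintro ⟨⟨s, r, R⟩, j⟩ ⟨h, hj⟩ ⟨⟨s', r', R'⟩, j'⟩ ⟨h', hj'⟩ he
    simp only [Prod.mk.injEq] at he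
    obtain ⟨rfl, rfl, he⟩ := he
    rcases le_total j j' with hle | hle
    · obtain ⟨rfl, rfl⟩ := key s r R R' j j' hle hj' h h' he
      rfl
    · obtain ⟨rfl, rfl⟩ := key s r R' R j' j hle hj h' h he.symm
      rfl

theorem one_sub_one_div_le_epsValF {L : Type*} [Field L] [Finite L] [Algebra (ZMod 2) L]
    {n q x : ℕ} (hn : 2 ≤ n) (hq : 0 < q) {F : Polynomial L} (hF : F ∈ PolySet L n)
    {D : Set L} (hDne : D.Nonempty) (hD0 : ∀ β ∈ D, β ≠ 0)
    (hD : ∀ β ∈ D, ∀ σ : L →ₐ[ZMod 2] L, σ β ∈ D)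
    (Vf : ℕ → Polynomial (ZMod 2)) (Wf : ℕ → L → Polynomial (ZMod 2)) :
    1 - 1 / (n : ℚ) ≤ epsValF L q x F D Vf Wf := by
  have hfin : (tripleSet L q D).Finite :=
    (Set.finite_Iio q).prod ((Set.toFinite _).prod (Set.toFinite _))
  have hsub : tripleSet L q D ⊆ failSetF L q x F D Vf Wf ∪ successSet L q x F D Vf Wf := by
    rintro t ⟨hs, hr, hR⟩
    by_cases h : aeval t.2.2 (Vf t.1) ≠ 0 ∧ aeval t.2.2 (Wf t.1 t.2.1) +
         (aeval t.2.2 (Vf t.1)) ^ x * (Polynomial.eval t.2.2 F + t.2.1) = 0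
    · exact Or.inr ⟨hs, hr, hR, h⟩
    · exact Or.inl ⟨hs, hr, hR, h⟩
  have hunion : (failSetF L q x F D Vf Wf ∪ successSet L q x F D Vf Wf).Finite :=
    hfin.subset (by
      rintro t (⟨hs, hr, hR, -⟩ | ⟨hs, hr, hR, -⟩)
      · exact ⟨hs, hr, hR⟩
      · exact ⟨hs, hr, hR⟩)
  have h1 := (Set.ncard_le_ncard hsub hunion).trans (Set.ncard_union_le _ _)
  rw [ncard_tripleSet] at h1
  have h2 := mul_ncard_successSet_le (q := q) (x := x) hn hF hD0 hD Vf Wf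
  have hDpos : 0 < D.ncard := (Set.ncard_pos (Set.toFinite _)).2 hDne
  have hpos : 0 < 2 * q * D.ncard := by positivity
  rw [epsValF]
  generalize 2 * q * D.ncard = N at *
  have h1' : (N : ℚ) ≤ (failSetF L q x F D Vf Wf).ncard +
      (successSet L q x F D Vf Wf).ncard := mod_cast h1
  have h2' : ((successSet L q x F D Vf Wf).ncard : ℚ) * n ≤ N := mod_cast h2
  have hN : (0 : ℚ) < N := mod_cast hpos
  have hn0 : (0 : ℚ) < n := by
    have : 0 < n := by omega
    exact_mod_cast this
  rw [le_div_iff₀ hN, sub_mul, one_mul, one_div_mul_eq_div]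
  have h3 := (le_div_iff₀ hn0).2 h2'
  linarith

/-- A lower bound for all summands of `etaValF` is a lower bound for their average. -/
theorem le_etaValF {L : Type*} [Field L] [Algebra (ZMod 2) L] {q : ℕ} (hq : 0 < q)
    {F : Polynomial L} {Dfam : ℕ → Set L} {Vf : ℕ → Polynomial (ZMod 2)}
    {Wf : ℕ → ℕ → L → Polynomial (ZMod 2)} {b : ℚ}
    (h : ∀ x < q, b ≤ epsValF L q x F (Dfam x) Vf (Wf x)) :
    b ≤ etaValF L q F Dfam Vf Wf := by
  have hsum := Finset.card_nsmul_le_sum (Finset.range q) _ b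
    fun x hx => h x (Finset.mem_range.1 hx)
  rw [Finset.card_range, nsmul_eq_mul] at hsum
  have hq' : (0 : ℚ) < q := mod_cast hq
  rw [etaValF, one_div_mul_eq_div, le_div_iff₀ hq']
  linarith

theorem N2_pos {L : Type*} [Field L] [Fintype L] [Algebra (ZMod 2) L] {n : ℕ}
    (hcard : Fintype.card L = 2 ^ n) : 1 ≤ N2 n := by
  have hfr : Module.finrank (ZMod 2) L = n := by
    have := Module.card_eq_pow_finrank (K := ZMod 2) (V := L)
    rw [hcard, ZMod.card] at this
    exact (Nat.pow_right_injective le_rfl this).symm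
  obtain ⟨α, hα⟩ := Field.exists_primitive_element (ZMod 2) L
  have hint : IsIntegral (ZMod 2) α := Algebra.IsIntegral.isIntegral α
  have hfin : {P : Polynomial (ZMod 2) | P.Monic ∧ Irreducible P ∧ P.natDegree = n}.Finite := by
    have : Finite (degreeLT (ZMod 2) (n + 1)) :=
      Finite.of_equiv _ (degreeLTEquiv (ZMod 2) (n + 1)).toEquiv.symm
    refine (Set.toFinite (degreeLT (ZMod 2) (n + 1) : Set (Polynomial (ZMod 2)))).subset ?_
    rintro P ⟨-, -, hP⟩
    rw [SetLike.mem_coe, mem_degreeLT]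
    refine degree_le_natDegree.trans_lt ?_
    rw [hP]
    exact_mod_cast Nat.lt_succ_self n
  refine (Set.ncard_pos hfin).2
    ⟨minpoly (ZMod 2) α, minpoly.monic hint, minpoly.irreducible hint, ?_⟩
  rw [← hfr]
  exact Field.primitive_element_iff_minpoly_natDegree_eq (ZMod 2) α |>.1 hα

theorem one_div_le_of_isGreatest_phiFn {n : ℕ} (hn : 2 ≤ n) (hN : 1 ≤ N2 n) {ω : ℚ}
    (hω : IsGreatest (phiFn n '' PhiSet n) ω) : 1 / (n : ℚ) ≤ ω := by
  refine hω.2 ⟨Pi.single n 1, ⟨?_, ?_, ?_, ?_⟩, ?_⟩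
  · rw [Pi.single_eq_of_ne (by omega)]
    exact zero_le_one
  · intro d _ hd
    rw [Pi.single_eq_of_ne (by omega)]
    exact Nat.zero_le _
  · simp
  · simpa using hN
  · have hmem : 1 ≤ n := by omega
    simp [phiFn, Pi.single_apply, hmem]

/-- For every `F ∈ 𝒫` and every `0 ≤ x < q`, `ε(n,g,x,F) ≥ 1 − ω(n)`; consequently,
if `2 ≤ n ≤ 6` or `n ≥ 7` is composite then `η(n,g,F) ≥ 1 − ω(n)`, and if `n ≥ 7` is
prime then `η(n,g,F) ≥ 1 − 2/n`. -/
theorem stmt16 {L : Type*} [Field L] [Fintype L] [Algebra (ZMod 2) L]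
    (n : ℕ) (hn : 2 ≤ n) (hcard : Fintype.card L = 2 ^ n)
    (g : L) (hg : orderOf g = 2 ^ n - 1)
    (F : Polynomial L) (hF : F ∈ PolySet L n)
    (Y : ℕ → Polynomial (ZMod 2))
    (hY : ∀ x < 2 ^ n - 1, (Y x).degree < (n : WithBot ℕ) ∧ aeval g (Y x) = g ^ x)
    (Dfam : ℕ → Set L)
    (hDfam : ∀ x, Dfam x = {β : L | β ≠ 0 ∧ aeval β (Y x) = β ^ x})
    (Vf : ℕ → Polynomial (ZMod 2))
    (hVf : ∀ s < 2 ^ n - 1, (Vf s).degree < (n : WithBot ℕ) ∧ aeval g (Vf s) = g ^ s)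
    (Wf : ℕ → ℕ → L → Polynomial (ZMod 2))
    (hWf : ∀ x < 2 ^ n - 1, ∀ s < 2 ^ n - 1, ∀ r : L, (r = 0 ∨ r = 1) →
      (Wf x s r).degree < (n : WithBot ℕ) ∧
        aeval g (Wf x s r) = g ^ (x * s) * (Polynomial.eval g F + r))
    (ω : ℚ) (hω : IsGreatest (phiFn n '' PhiSet n) ω) :
    (∀ x < 2 ^ n - 1, epsValF L (2 ^ n - 1) x F (Dfam x) Vf (Wf x) ≥ 1 - ω) ∧
      (((2 ≤ n ∧ n ≤ 6) ∨ (7 ≤ n ∧ ¬ n.Prime)) →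
        etaValF L (2 ^ n - 1) F Dfam Vf Wf ≥ 1 - ω) ∧
      ((7 ≤ n ∧ n.Prime) →
        etaValF L (2 ^ n - 1) F Dfam Vf Wf ≥ 1 - 2 / (n : ℚ)) := by
  have hq : 0 < 2 ^ n - 1 := by
    have : 2 ^ 2 ≤ 2 ^ n := Nat.pow_le_pow_right two_pos hn
    omega
  have hg0 : g ≠ 0 := by
    rintro rfl
    rw [orderOf_zero] at hg
    omega
  have heps : ∀ x < 2 ^ n - 1,
      1 - 1 / (n : ℚ) ≤ epsValF L (2 ^ n - 1) x F (Dfam x) Vf (Wf x) := by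
    intro x hx
    apply one_sub_one_div_le_epsValF hn hq hF <;> rw [hDfam]
    · exact ⟨g, hg0, (hY x hx).2⟩
    · exact fun β hβ => hβ.1
    · rintro β ⟨hβ0, hβ⟩ σ
      exact ⟨(map_ne_zero σ).2 hβ0, by rw [aeval_algHom_apply, hβ, map_pow]⟩
  have hω' := one_div_le_of_isGreatest_phiFn hn (N2_pos hcard) hω
  have h2n : 1 / (n : ℚ) ≤ 2 / n := by gcongr; norm_num
  have heta := le_etaValF hq heps
  exact ⟨fun x hx => (sub_le_sub_left hω' 1).trans (heps x hx),
    fun _ => (sub_le_sub_left hω' 1).trans heta,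
    fun _ => (sub_le_sub_left h2n 1).trans heta⟩
end

section
/- Let u ≥ 0 and x ≥ 0 be integers, let V, W ∈ K[t], let r ∈ K, and let F(t) = Σ_{k=0}^{d} F_k·t^k ∈ L[t] be such that for some index l the coefficient F_l has multiplicative order p^n − 1 in L^× while F_k ∈ K for every k ≠ l. Let D_u = {g^(u·p^j) : 0 ≤ j < n} be the Frobenius orbit of g^u. Then either V(β) = 0 for every β ∈ D_u, or the set {β ∈ D_u : W(β) = V(β)^x·(F(β) + r)} has at most one element. -/
open Polynomial

/-- The Frobenius orbit `D_u = {g^(u·p^j) : 0 ≤ j < n}` of `g^u`. -/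
def gOrbitP {L : Type*} [Monoid L] (p n : ℕ) (g : L) (u : ℕ) : Set L :=
  {γ | ∃ j < n, γ = g ^ (u * p ^ j)}

theorem RingHom.map_aeval_zmod {p : ℕ} {L : Type*} [Field L] [Algebra (ZMod p) L] (σ : L →+* L)
    (V : Polynomial (ZMod p)) (β : L) : σ (aeval β V) = aeval (σ β) V := by
  rw [aeval_def, aeval_def, hom_eval₂, Subsingleton.elim (σ.comp _) (algebraMap (ZMod p) L)]

theorem RingHom.map_algebraMap_zmod {p : ℕ} {L : Type*} [Field L] [Algebra (ZMod p) L]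
    (σ : L →+* L) (r : ZMod p) : σ (algebraMap (ZMod p) L r) = algebraMap (ZMod p) L r :=
  RingHom.congr_fun (Subsingleton.elim (σ.comp (algebraMap (ZMod p) L)) _) r

/-- If all coefficients of `F` but the `l`-th are fixed by `σ`, and `σ (F(β)) = F(σ β)` with
`β ≠ 0`, then the `l`-th coefficient is fixed as well. -/
theorem Polynomial.map_coeff_eq_of_map_eval_eq {L : Type*} [Field L] (σ : L →+* L) (F : L[X])
    (l : ℕ) (hF : ∀ k, k ≠ l → σ (F.coeff k) = F.coeff k) {β : L} (hβ : β ≠ 0)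
    (h : σ (F.eval β) = F.eval (σ β)) : σ (F.coeff l) = F.coeff l := by
  have key : F.map σ - F = monomial l (σ (F.coeff l) - F.coeff l) := by
    ext k
    rw [coeff_sub, coeff_map, coeff_monomial]
    split_ifs with hk
    · rw [hk]
    · rw [hF k (Ne.symm hk), sub_self]
  have hev := congrArg (eval (σ β)) key
  rw [eval_sub, eval_map_apply, h, sub_self, eval_monomial] at hev
  have hσ : σ β ^ l ≠ 0 := pow_ne_zero _ ((_root_.map_ne_zero σ).2 hβ)
  exact sub_eq_zero.1 ((mul_eq_zero.1 hev.symm).resolve_right hσ)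

/-- A unit of order `p ^ n - 1` is not fixed by `x ↦ x ^ p ^ j` for `0 < j < n`. -/
theorem pow_prime_pow_ne_self {p n j : ℕ} (hp : p.Prime) {L : Type*} [Field L] {c : L} (hc : c ≠ 0)
    (ho : orderOf c = p ^ n - 1) (hj : 0 < j) (hjn : j < n) : c ^ p ^ j ≠ c := by
  intro h
  have h1 : 1 < p ^ j := Nat.one_lt_pow hj.ne' hp.one_lt
  have h2 : p ^ j < p ^ n := Nat.pow_lt_pow_right hp.one_lt hjn
  have h3 : c ^ (p ^ j - 1) = 1 := by
    apply mul_right_cancel₀ hc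
    rw [← pow_succ, Nat.sub_add_cancel h1.le, h, one_mul]
  have h4 := Nat.le_of_dvd (by omega) (orderOf_dvd_of_pow_eq_one h3)
  omega

/-- For `V, W ∈ K[t]`, `r ∈ K` (`K = GF(p)`), and `F ∈ L[t]` with one coefficient of
multiplicative order `p^n − 1` and all other coefficients in `K`: either `V` vanishes on
the whole Frobenius orbit `D_u`, or `{β ∈ D_u : W(β) = V(β)^x·(F(β) + r)}` has at most
one element. -/
theorem stmt18 (p : ℕ) (hp : p.Prime) {L : Type*} [Field L] [Fintype L]
    [Algebra (ZMod p) L]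
    (n : ℕ) (hn : 2 ≤ n) (hcard : Fintype.card L = p ^ n)
    (g : L) (hg : orderOf g = p ^ n - 1)
    (u x : ℕ) (V W : Polynomial (ZMod p)) (r : ZMod p)
    (F : Polynomial L)
    (hF : ∃ l, orderOf (F.coeff l) = p ^ n - 1 ∧
      ∀ k, k ≠ l → F.coeff k ∈ Set.range (algebraMap (ZMod p) L)) :
    (∀ β ∈ gOrbitP p n g u, aeval β V = 0) ∨
      {β ∈ gOrbitP p n g u |
        aeval β W =
          (aeval β V) ^ x * (Polynomial.eval β F + algebraMap (ZMod p) L r)}.Subsingleton := by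
  have : Fact p.Prime := ⟨hp⟩
  have : CharP L p := charP_of_injective_algebraMap (algebraMap (ZMod p) L).injective p
  obtain ⟨l, hl, hF⟩ := hF
  have hpos : p ^ n - 1 ≠ 0 := by
    have := Nat.one_lt_pow (show n ≠ 0 by omega) hp.one_lt
    omega
  have ne_zero_of_order : ∀ c : L, orderOf c = p ^ n - 1 → c ≠ 0 := by
    rintro c hc rfl
    exact hpos (by rw [← hc, orderOf_zero])
  have hg0 := ne_zero_of_order g hg
  have hc0 := ne_zero_of_order _ hl
  have frob : ∀ a : ℕ, g ^ (u * p ^ a) = iterateFrobenius L p a (g ^ u) := fun a ↦ by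
    rw [iterateFrobenius_def, pow_mul]
  by_cases hV : aeval (g ^ u) V = 0
  · left
    rintro β ⟨j, -, rfl⟩
    rw [frob, ← RingHom.map_aeval_zmod, hV, map_zero]
  right
  have key : ∀ a b : ℕ, a < b → b < n →
      aeval (g ^ (u * p ^ a)) W = (aeval (g ^ (u * p ^ a)) V) ^ x *
        (eval (g ^ (u * p ^ a)) F + algebraMap (ZMod p) L r) →
      aeval (g ^ (u * p ^ b)) W = (aeval (g ^ (u * p ^ b)) V) ^ x *
        (eval (g ^ (u * p ^ b)) F + algebraMap (ZMod p) L r) → False := by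
    intro a b hab hbn ha hb
    have hσβ : g ^ (u * p ^ b) = iterateFrobenius L p (b - a) (g ^ (u * p ^ a)) := by
      rw [iterateFrobenius_def, ← pow_mul, mul_assoc, ← pow_add, Nat.add_sub_cancel' hab.le]
    have hVb : aeval (g ^ (u * p ^ b)) V ≠ 0 := by
      rw [frob, ← RingHom.map_aeval_zmod]
      exact (_root_.map_ne_zero _).2 hV
    have ha' := congrArg (iterateFrobenius L p (b - a)) ha
    rw [map_mul, map_pow, map_add, RingHom.map_aeval_zmod, RingHom.map_aeval_zmod,
      RingHom.map_algebraMap_zmod, ← hσβ, hb] at ha'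
    have hev := add_right_cancel (mul_left_cancel₀ (pow_ne_zero x hVb) ha')
    rw [hσβ] at hev
    have hfix := map_coeff_eq_of_map_eval_eq (iterateFrobenius L p (b - a)) F l
      (fun k hk ↦ by
        obtain ⟨s, hs⟩ := hF k hk
        rw [← hs, RingHom.map_algebraMap_zmod])
      (pow_ne_zero _ hg0) hev.symm
    rw [iterateFrobenius_def] at hfix
    exact pow_prime_pow_ne_self hp hc0 hl (by omega) (by omega) hfix
  rintro _ ⟨⟨a, ha, rfl⟩, hWa⟩ _ ⟨⟨b, hb, rfl⟩, hWb⟩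
  rcases lt_trichotomy a b with h | h | h
  · exact (key a b h hb hWa hWb).elim
  · rw [h]
  · exact (key b a h ha hWb hWa).elim
end
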